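/- arXiv:2106.02534 — 3 statements merged into one kernel-verified Lean document; each statement's English description precedes it below -/
import Mathlib

section
/- For every integer n ≥ 3, the number of cyclic permutations of length n avoiding both cyclic patterns [1234] and [1324] equals 2(n−2); that is, #Av_n([1234],[1324]) = 2(n−2). -/
/-- A sequence `σ` of length `n` (with distinct values) contains the pattern `π`
of length `k` if some subsequence of `σ` is order isomorphic to `π`. -/
def ContainsPat {n k : ℕ} (σ : Fin n → Fin n) (π : Fin k → ℕ) : Prop :=
  ∃ f : Fin k → Fin n, StrictMono f ∧ ∀ i j : Fin k, π i < π j ↔ σ (f i) < σ (f j)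

/-- The rotation of the sequence `σ` starting at position `r`. -/
def rotSeq {n : ℕ} (σ : Fin n → Fin n) (r : Fin n) : Fin n → Fin n :=
  fun i => σ (i + r)

/-- The cyclic permutation `[σ]` contains the cyclic pattern `[π]` if some
rotation of `σ` contains `π` linearly. -/
def CycContains {n k : ℕ} (σ : Fin n → Fin n) (π : Fin k → ℕ) : Prop :=
  ∃ r : Fin n, ContainsPat (rotSeq σ r) π

/-- The cyclic permutation `[σ]` avoids the cyclic pattern `[π]`. -/
def CycAvoids {n k : ℕ} (σ : Fin n → Fin n) (π : Fin k → ℕ) : Prop :=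
  ¬ CycContains σ π

/-- The cyclic permutation `[σ]`, i.e. the set of all rotations of `σ`. -/
def CycClass {n : ℕ} (σ : Fin n → Fin n) : Set (Fin n → Fin n) :=
  Set.range (rotSeq σ)

/-- The set of cyclic permutations (rotation classes) of length `n` all of whose
representatives are permutations and which satisfy the (rotation-invariant)
predicate `P`. -/
def AvClasses (n : ℕ) (P : (Fin n → Fin n) → Prop) : Set (Set (Fin n → Fin n)) :=
  { C | ∃ σ : Equiv.Perm (Fin n), C = CycClass ⇑σ ∧ P ⇑σ }

/-- The cyclic descent number: the number of indices `i` (mod `n`) with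
`σ i > σ (i+1)`. -/
def cdes {n : ℕ} (σ : Fin n → Fin n) : ℕ :=
  (Finset.univ.filter fun i : Fin n =>
    σ ⟨(↑i + 1) % n, Nat.mod_lt _ i.pos⟩ < σ i).card

/-- The cyclic peak number: the number of indices `i` (mod `n`) with
`σ (i-1) < σ i > σ (i+1)`. -/
def cpk {n : ℕ} (σ : Fin n → Fin n) : ℕ :=
  (Finset.univ.filter fun i : Fin n =>
    σ ⟨(↑i + (n - 1)) % n, Nat.mod_lt _ i.pos⟩ < σ i ∧
    σ ⟨(↑i + 1) % n, Nat.mod_lt _ i.pos⟩ < σ i).card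

/-- Four positions in cyclic order. -/
def Cyc4 (p q r s : ℕ) : Prop :=
  (p < q ∧ q < r ∧ r < s) ∨ (q < r ∧ r < s ∧ s < p) ∨
  (r < s ∧ s < p ∧ p < q) ∨ (s < p ∧ p < q ∧ q < r)

lemma cyc4_of_mono {n : ℕ} (g : Fin 4 → Fin n) (hg : StrictMono g) (r : Fin n) :
    Cyc4 (g 0 + r : Fin n) (g 1 + r : Fin n) (g 2 + r : Fin n) (g 3 + r : Fin n) := by
  have h1 : g 0 < g 1 := hg (by decide)
  have h2 : g 1 < g 2 := hg (by decide)
  have h3 : g 2 < g 3 := hg (by decide)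
  have := (g 3).isLt
  have := r.isLt
  simp only [Fin.lt_def] at h1 h2 h3
  unfold Cyc4
  simp only [Fin.val_add_eq_ite]
  split_ifs <;> omega

lemma exists_of_cyc4 {n : ℕ} [NeZero n] (p q r s : Fin n) (h : Cyc4 p q r s) :
    ∃ (t : Fin n) (g : Fin 4 → Fin n), StrictMono g ∧
      g 0 + t = p ∧ g 1 + t = q ∧ g 2 + t = r ∧ g 3 + t = s := by
  refine ⟨p, ![0, q - p, r - p, s - p], ?_, ?_, ?_, ?_, ?_⟩
  · rw [Fin.strictMono_iff_lt_succ]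
    have key : ∀ x : Fin n, ((x - p : Fin n) : ℕ) =
        if (p : ℕ) ≤ x then (x : ℕ) - p else n + x - p := by
      intro x
      have := x.isLt
      have := p.isLt
      rw [Fin.val_sub]
      split_ifs with h
      · rw [show n - (p : ℕ) + x = (x - p) + n by omega, Nat.add_mod_right, Nat.mod_eq_of_lt]
        omega
      · rw [Nat.mod_eq_of_lt] <;> omega
    have := q.isLt
    have := p.isLt
    have := r.isLt
    have := s.isLt
    unfold Cyc4 at h
    intro i
    fin_cases i
    · simp [Fin.lt_def, key]; split_ifs <;> omega
    · simp [Fin.lt_def, key]; split_ifs <;> omega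
    · simp [Fin.lt_def, key]; split_ifs <;> omega
  all_goals simp

lemma cyc1234 {n : ℕ} [NeZero n] (f : Fin n → Fin n) :
    CycAvoids f ![1,2,3,4] ↔ ∀ p q r s : Fin n, Cyc4 p q r s →
      ¬ (f p < f q ∧ f q < f r ∧ f r < f s) := by
  constructor
  · intro h p q r s hc hf
    obtain ⟨t, g, hg, h0, h1, h2, h3⟩ := exists_of_cyc4 p q r s hc
    refine h ⟨t, g, hg, ?_⟩
    intro i j
    have a1 := hf.1
    have a2 := hf.2.1
    have a3 := hf.2.2
    fin_cases i <;> fin_cases j <;> simp [rotSeq, h0, h1, h2, h3] <;> omega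
  · rintro h ⟨t, g, hg, hp⟩
    refine h _ _ _ _ (cyc4_of_mono g hg t) ⟨?_, ?_, ?_⟩
    · exact (hp 0 1).1 (by decide)
    · exact (hp 1 2).1 (by decide)
    · exact (hp 2 3).1 (by decide)

lemma cyc1324 {n : ℕ} [NeZero n] (f : Fin n → Fin n) :
    CycAvoids f ![1,3,2,4] ↔ ∀ p q r s : Fin n, Cyc4 p q r s →
      ¬ (f p < f r ∧ f r < f q ∧ f q < f s) := by
  constructor
  · intro h p q r s hc hf
    obtain ⟨t, g, hg, h0, h1, h2, h3⟩ := exists_of_cyc4 p q r s hc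
    refine h ⟨t, g, hg, ?_⟩
    intro i j
    have a1 := hf.1
    have a2 := hf.2.1
    have a3 := hf.2.2
    fin_cases i <;> fin_cases j <;> simp [rotSeq, h0, h1, h2, h3] <;> omega
  · rintro h ⟨t, g, hg, hp⟩
    refine h _ _ _ _ (cyc4_of_mono g hg t) ⟨?_, ?_, ?_⟩
    · exact (hp 0 2).1 (by decide)
    · exact (hp 2 1).1 (by decide)
    · exact (hp 1 3).1 (by decide)

/-- The combined avoidance predicate. -/
def Good {n : ℕ} (f : Fin n → Fin n) : Prop :=
  CycAvoids f ![1,2,3,4] ∧ CycAvoids f ![1,3,2,4]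

lemma good_iff {n : ℕ} [NeZero n] (f : Fin n → Fin n) :
    Good f ↔ ∀ p q r s : Fin n, Cyc4 p q r s →
      ¬ (f p < f q ∧ f q < f r ∧ f r < f s) ∧ ¬ (f p < f r ∧ f r < f q ∧ f q < f s) := by
  unfold Good
  rw [cyc1234, cyc1324]
  exact ⟨fun h p q r s hc => ⟨h.1 p q r s hc, h.2 p q r s hc⟩,
    fun h => ⟨fun p q r s hc => (h p q r s hc).1, fun p q r s hc => (h p q r s hc).2⟩⟩

lemma rot_rot {n : ℕ} [NeZero n] (f : Fin n → Fin n) (r s : Fin n) :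
    rotSeq (rotSeq f r) s = rotSeq f (s + r) := by
  funext i; simp [rotSeq, add_assoc]

lemma good_rot {n : ℕ} [NeZero n] (f : Fin n → Fin n) (r : Fin n) (h : Good f) :
    Good (rotSeq f r) := by
  refine ⟨?_, ?_⟩
  · rintro ⟨s, hs⟩
    exact h.1 ⟨s + r, by rwa [rot_rot] at hs⟩
  · rintro ⟨s, hs⟩
    exact h.2 ⟨s + r, by rwa [rot_rot] at hs⟩

lemma class_rot {n : ℕ} [NeZero n] (f : Fin n → Fin n) (r : Fin n) :
    CycClass (rotSeq f r) = CycClass f := by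
  ext g
  constructor
  · rintro ⟨s, rfl⟩
    exact ⟨s + r, (rot_rot f r s).symm⟩
  · rintro ⟨s, rfl⟩
    exact ⟨s - r, by rw [rot_rot, sub_add_cancel]⟩

/-- The explicit normalised avoiders, as value functions. -/
def famVal (n c j : ℕ) : ℕ :=
  if c < n - 1 then
    (if j = 0 then 0 else if j = 1 then n - (c + 1) else if j ≤ c + 1 then n + 1 - j else n - j)
  else
    (if j = 0 then 0 else if j = c + 3 - n then n - j - 1
      else if j = c + 4 - n then n + 1 - j else n - j)

/-- The explicit normalised avoiders. -/
def fam (n c : ℕ) : Fin n → Fin n :=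
  fun j => ⟨min (famVal n c j) (n - 1), by have := j.isLt; omega⟩

lemma fam_val {n c : ℕ} (hn : 3 ≤ n) (hc : c < 2 * (n - 2)) (j : Fin n) :
    (fam n c j : ℕ) = famVal n c j := by
  have := j.isLt
  simp only [fam]
  rw [min_eq_left]
  unfold famVal
  split_ifs <;> omega

lemma fam_inj {n c : ℕ} (hn : 3 ≤ n) (hc : c < 2 * (n - 2)) :
    Function.Injective (fam n c) := by
  intro i j h
  have h' := congrArg Fin.val h
  rw [fam_val hn hc, fam_val hn hc] at h'
  have := i.isLt
  have := j.isLt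
  ext
  unfold famVal at h'
  split_ifs at h' <;> omega

lemma fam_code_inj {n c d : ℕ} (hn : 3 ≤ n) (hc : c < 2 * (n - 2)) (hd : d < 2 * (n - 2))
    (h : fam n c = fam n d) : c = d := by
  have key : ∀ j < n, famVal n c j = famVal n d j := by
    intro j hj
    rw [← fam_val hn hc ⟨j, hj⟩, ← fam_val hn hd ⟨j, hj⟩, h]
  by_cases h1 : c < n - 1 <;> by_cases h2 : d < n - 1
  · have := key 1 (by omega)
    simp [famVal, h1, h2] at this
    omega
  · have a := key 1 (by omega)
    have b := key (d + 3 - n) (by omega)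
    simp only [famVal, h1, h2, if_true, if_false] at a b
    split_ifs at a b <;> omega
  · have a := key 1 (by omega)
    have b := key (c + 3 - n) (by omega)
    simp only [famVal, h1, h2, if_true, if_false] at a b
    split_ifs at a b <;> omega
  · have b := key (c + 3 - n) (by omega)
    simp only [famVal, h1, h2, if_true, if_false] at b
    split_ifs at b <;> omega

lemma good_of_struct {n : ℕ} [NeZero n] (f : Fin n → Fin n) (h0 : (f 0 : ℕ) = 0)
    (h : (∀ i j : Fin n, 0 < (i : ℕ) → i < j → f i < f j → (i : ℕ) = 1) ∨
      (∃ b : ℕ, ∀ i j : Fin n, 0 < (i : ℕ) → i < j → f i < f j → (i : ℕ) = b ∧ (j : ℕ) = b + 1)) :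
    Good f := by
  rw [good_iff]
  have hz : ∀ i : Fin n, (i : ℕ) = 0 → (f i : ℕ) = 0 := by
    intro i hi
    have : i = 0 := by ext; simpa using hi
    rw [this, h0]
  intro p q r s hc
  have := hz p
  have := hz q
  have := hz r
  have := hz s
  simp only [Fin.lt_def] at h ⊢
  rcases h with h | ⟨b, h⟩ <;> rcases hc with hc | hc | hc | hc
  · have := h p q; have := h p r; have := h p s; have := h q r; have := h q s; have := h r s
    omega
  · have := h q r; have := h q s; have := h q p; have := h r s; have := h r p; have := h s p
    omega
  · have := h r s; have := h r p; have := h r q; have := h s p; have := h s q; have := h p q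
    omega
  · have := h s p; have := h s q; have := h s r; have := h p q; have := h p r; have := h q r
    omega
  · have := h p q; have := h p r; have := h p s; have := h q r; have := h q s; have := h r s
    omega
  · have := h q r; have := h q s; have := h q p; have := h r s; have := h r p; have := h s p
    omega
  · have := h r s; have := h r p; have := h r q; have := h s p; have := h s q; have := h p q
    omega
  · have := h s p; have := h s q; have := h s r; have := h p q; have := h p r; have := h q r
    omega

lemma fam_good {n c : ℕ} [NeZero n] (hn : 3 ≤ n) (hc : c < 2 * (n - 2)) : Good (fam n c) := by
  apply good_of_struct
  · rw [fam_val hn hc]; simp [famVal]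
  · by_cases h : c < n - 1
    · left
      intro i j hi hij hf
      rw [Fin.lt_def, fam_val hn hc, fam_val hn hc] at hf
      rw [Fin.lt_def] at hij
      have := j.isLt
      simp only [famVal, h, if_true] at hf
      split_ifs at hf <;> omega
    · right
      refine ⟨c + 3 - n, ?_⟩
      intro i j hi hij hf
      rw [Fin.lt_def, fam_val hn hc, fam_val hn hc] at hf
      rw [Fin.lt_def] at hij
      have := j.isLt
      simp only [famVal, h, if_false] at hf
      split_ifs at hf <;> omega

lemma eq_of_order {n : ℕ} (f g : Fin n → Fin n) (hf : Function.Injective f)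
    (hg : Function.Injective g) (h : ∀ i j, i < j → (f i < f j ↔ g i < g j)) : f = g := by
  have h' : ∀ i j, f i < f j → g i < g j := by
    intro i j hij
    rcases lt_trichotomy i j with hl | hl | hl
    · exact (h i j hl).1 hij
    · subst hl; exact absurd hij (lt_irrefl _)
    · have h1 := (h j i hl).not.1 (not_lt.2 hij.le)
      exact lt_of_le_of_ne (not_lt.1 h1) (fun he => hl.ne' (hg he))
  let e : Fin n ≃ Fin n := Equiv.ofBijective f (Finite.injective_iff_bijective.1 hf)
  have hm : StrictMono (g ∘ e.symm) := by
    intro a b hab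
    apply h'
    have h1 : f (e.symm a) = a := e.apply_symm_apply a
    have h2 : f (e.symm b) = b := e.apply_symm_apply b
    rwa [h1, h2]
  have hid : g ∘ e.symm = id := by
    apply (StrictMono.range_inj hm strictMono_id).1
    rw [Set.range_id, Set.range_eq_univ]
    exact (Finite.injective_iff_surjective.1 hg).comp e.symm.surjective
  funext i
  have := congrFun hid (e i)
  simp at this
  exact this.symm

lemma good_struct {n : ℕ} [NeZero n] (hn : 3 ≤ n) (f : Fin n → Fin n)
    (hf : Function.Injective f) (h0 : (f 0 : ℕ) = 0) (hg : Good f) :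
    ∃ c < 2 * (n - 2), fam n c = f := by
  rw [good_iff] at hg
  have hne : ∀ i j : Fin n, (i : ℕ) ≠ j → (f i : ℕ) ≠ f j := by
    intro i j hij he
    exact hij (congrArg Fin.val (hf (Fin.ext he)))
  have z0 : ((0 : Fin n) : ℕ) = 0 := by simp
  have hpos : ∀ i : Fin n, 0 < (i : ℕ) → 0 < (f i : ℕ) := by
    intro i hi
    have := hne i 0 (by omega)
    omega
  simp only [Fin.lt_def] at hg
  unfold Cyc4 at hg
  -- each position has at most one smaller predecessor
  have c1 : ∀ i i' j : Fin n, 0 < (i : ℕ) → (i : ℕ) < i' → (i' : ℕ) < j →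
      ¬ ((f i : ℕ) < f j ∧ (f i' : ℕ) < f j) := by
    rintro i i' j hi hii hij ⟨h1, h2⟩
    have := hg 0 i i' j (by omega)
    have := hpos i hi
    have := hpos i' (by omega)
    have := hne i i' (by omega)
    omega
  have c2 : ∀ i j i' j' : Fin n, 0 < (i : ℕ) → (i : ℕ) < j → (f i : ℕ) < f j →
      (i' : ℕ) < j' → (f i' : ℕ) < f j' → ¬ ((i : ℕ) < i') := by
    intro i j i' j' hi hij h1 hij' h2 hii
    have a1 := c1 i i' j' hi hii hij'
    have a2 := c1 i i' j hi hii
    have a3 := hne i j' (by omega)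
    rcases lt_trichotomy (j : ℕ) i' with h | h | h
    · have := hg i' j' i j (by omega)
      omega
    · have : j = i' := Fin.ext h
      subst this
      omega
    · have := hne i i' (by omega)
      omega
  by_cases hall : ∀ i j : Fin n, 0 < (i : ℕ) → (i : ℕ) < j → (f i : ℕ) < f j → (i : ℕ) = 1
  · -- family A
    obtain ⟨one, hone⟩ : ∃ o : Fin n, (o : ℕ) = 1 := ⟨⟨1, by omega⟩, rfl⟩
    obtain ⟨t, ht, htm⟩ : ∃ t : Fin n, f one ≤ f t ∧ ∀ j, f one ≤ f j → j ≤ t := by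
      classical
      have hS : (Finset.univ.filter fun j => f one ≤ f j).Nonempty := ⟨one, by simp⟩
      obtain ⟨t, h1, h2⟩ := Finset.exists_max_image _ id hS
      refine ⟨t, by simpa using h1, fun j hj => h2 j (by simpa using hj)⟩
    have ht1 : 1 ≤ (t : ℕ) := by
      have := Fin.le_def.1 (htm one le_rfl)
      omega
    have ht2 : ∀ j : Fin n, (f one : ℕ) ≤ f j → (j : ℕ) ≤ t := fun j hj => htm j hj
    rw [Fin.le_def] at ht
    have htn := t.isLt
    have hc : (t : ℕ) - 1 < 2 * (n - 2) := by omega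
    refine ⟨t - 1, hc, ?_⟩
    apply eq_of_order _ _ (fam_inj hn hc) hf
    intro i j hij
    rw [Fin.lt_def] at hij
    rw [Fin.lt_def, fam_val hn hc, fam_val hn hc, Fin.lt_def]
    have hj := j.isLt
    simp only [famVal, show (t : ℕ) - 1 < n - 1 by omega, if_true]
    have htc : (t : ℕ) - 1 + 1 = t := by omega
    rw [htc]
    rcases Nat.lt_trichotomy (i : ℕ) 1 with h | h | h
    · have : i = 0 := by ext; simp; omega
      subst this
      have := hpos j (by omega)
      split_ifs <;> omega
    · have : i = one := Fin.ext (h.trans hone.symm)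
      subst this
      have b1 := ht2 j
      have b2 := hall j t (by omega)
      have b3 := hne i j (by omega)
      have b4 : (j : ℕ) = t → (f j : ℕ) = f t := fun h => by rw [Fin.ext h]
      split_ifs <;> omega
    · have := hall i j (by omega) hij
      split_ifs <;> omega
  · push Not at hall
    obtain ⟨i, j, hi, hij, hfij, hi1⟩ := hall
    have uniq : ∀ i' j' : Fin n, 0 < (i' : ℕ) → (i' : ℕ) < j' → (f i' : ℕ) < f j' →
        (i' : ℕ) = i ∧ (j' : ℕ) = j := by
      intro i' j' hi' hij' hf'
      have e : (i' : ℕ) = i := by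
        have := c2 i j i' j' hi hij hfij hij' hf'
        have := c2 i' j' i j hi' hij' hf' hij hfij
        omega
      have e' : i' = i := Fin.ext e
      subst e'
      refine ⟨rfl, ?_⟩
      obtain ⟨one, hone⟩ : ∃ o : Fin n, (o : ℕ) = 1 := ⟨⟨1, by omega⟩, rfl⟩
      have d1 := c1 one i' j (by omega) (by omega) (by omega)
      have d2 := c1 one i' j' (by omega) (by omega) (by omega)
      have d7 := hne one j (by omega)
      have d8 := hne one j' (by omega)
      rcases Nat.lt_trichotomy (j : ℕ) j' with h | h | h
      · have d3 := c1 i' j j' hi' hij h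
        have d5 := hg i' j j' one (by omega)
        have d9 := hne j j' (by omega)
        omega
      · exact h.symm
      · have d4 := c1 i' j' j hi' hij' h
        have d6 := hg i' j' j one (by omega)
        have d9 := hne j j' (by omega)
        omega
    have hj : (j : ℕ) = i + 1 := by
      by_contra hcon
      let k : Fin n := ⟨i + 1, by have := j.isLt; omega⟩
      have hk : (k : ℕ) = i + 1 := rfl
      have := uniq i k
      have := uniq k j
      have := hne i k
      have := hne k j
      omega
    have hjn := j.isLt
    have hc : (i : ℕ) + n - 3 < 2 * (n - 2) := by omega
    refine ⟨i + n - 3, hc, ?_⟩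
    apply eq_of_order _ _ (fam_inj hn hc) hf
    intro a b hab
    rw [Fin.lt_def] at hab
    rw [Fin.lt_def, fam_val hn hc, fam_val hn hc, Fin.lt_def]
    have hb := b.isLt
    simp only [famVal, show ¬ ((i : ℕ) + n - 3 < n - 1) by omega, if_false,
      show (i : ℕ) + n - 3 + 3 - n = i by omega, show (i : ℕ) + n - 3 + 4 - n = i + 1 by omega]
    rcases Nat.eq_zero_or_pos (a : ℕ) with h | h
    · have : a = 0 := by ext; simp; omega
      subst this
      have := hpos b (by omega)
      split_ifs <;> omega
    · have u := uniq a b h hab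
      have v : (a : ℕ) = i → (b : ℕ) = i + 1 → (f a : ℕ) < f b := by
        intro h1 h2
        rw [Fin.ext h1, Fin.ext (h2.trans hj.symm)]
        exact hfij
      split_ifs <;> omega

theorem card_av_1234_1324 (n : ℕ) (hn : 3 ≤ n) :
    (AvClasses n fun σ => CycAvoids σ ![1,2,3,4] ∧ CycAvoids σ ![1,3,2,4]).ncard = 2 * (n - 2) := by
  have : NeZero n := ⟨by omega⟩
  have hfz : ∀ c, c < 2 * (n - 2) → fam n c 0 = 0 := by
    intro c hc
    ext
    rw [fam_val hn hc]; simp [famVal]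
  have himg : (AvClasses n fun σ => CycAvoids σ ![1,2,3,4] ∧ CycAvoids σ ![1,3,2,4]) =
      Set.image (fun c => CycClass (fam n c)) (Finset.range (2 * (n - 2)) : Set ℕ) := by
    ext C
    constructor
    · rintro ⟨σ, rfl, hσ⟩
      have hgood : Good (rotSeq σ (σ.symm 0)) := good_rot _ _ hσ
      obtain ⟨c, hc, he⟩ := good_struct hn (rotSeq σ (σ.symm 0))
        (fun a b hab => by simpa [rotSeq] using hab) (by simp [rotSeq]) hgood
      exact ⟨c, by simpa using hc, by simp only [he, class_rot]⟩
    · rintro ⟨c, hc, rfl⟩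
      have hc' : c < 2 * (n - 2) := by simpa using hc
      exact ⟨Equiv.ofBijective (fam n c) (Finite.injective_iff_bijective.1 (fam_inj hn hc')),
        rfl, fam_good hn hc'⟩
  rw [himg, Set.InjOn.ncard_image, Set.ncard_coe_finset, Finset.card_range]
  intro c hc d hd hcd
  have hc' : c < 2 * (n - 2) := by simpa using hc
  have hd' : d < 2 * (n - 2) := by simpa using hd
  have hmem : fam n c ∈ CycClass (fam n d) := by
    have hcd' : CycClass (fam n c) = CycClass (fam n d) := hcd
    rw [← hcd']
    exact ⟨0, by funext i; simp [rotSeq]⟩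
  obtain ⟨r, hr⟩ := hmem
  have h1 : fam n d r = 0 := by
    have := congrFun hr 0
    rw [hfz c hc'] at this
    simpa [rotSeq] using this
  have h2 : r = 0 := fam_inj hn hd' (h1.trans (hfz d hd').symm)
  subst h2
  apply fam_code_inj hn hc' hd'
  rw [← hr]
  funext i; simp [rotSeq]
end

section
/- For every integer n ≥ 2, the cyclic descent generating polynomial over cyclic permutations of length n avoiding the cyclic pattern [1324] satisfies D_n([1324]; q) = Σ_{k=1}^{n−1} binom(n+k−3, n−k−1) q^k; equivalently, for each k with 1 ≤ k ≤ n−1, the number of cyclic permutations of length n avoiding [1324] with exactly k cyclic descents is binom(n+k−3, n−k−1). -/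
open List in
/-- A list avoids the linear patterns 213 and 4132. -/
def LAv (l : List ℕ) : Prop :=
  (∀ a b c, [a, b, c] <+ l → b < a → a < c → False) ∧
  (∀ a b c d, [a, b, c, d] <+ l → b < d → d < c → c < a → False)

/-- Number of descents of a list. -/
def ldes : List ℕ → ℕ
  | [] => 0
  | [_] => 0
  | a :: b :: l => (if b < a then 1 else 0) + ldes (b :: l)

open Classical in
/-- Arrangements of `lo, …, lo+m-1` avoiding both patterns with `d` descents. -/
noncomputable def LG (m lo d : ℕ) : Finset (List ℕ) :=
  (List.range' lo m).permutations.toFinset.filter fun l => LAv l ∧ ldes l = d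

theorem mem_LG {m lo d : ℕ} {l : List ℕ} :
    l ∈ LG m lo d ↔ l.Perm (List.range' lo m) ∧ LAv l ∧ ldes l = d := by
  classical
  simp [LG, List.mem_permutations]

attribute [irreducible] LG

theorem LAv.sub {l l' : List ℕ} (h : LAv l) (hs : l'.Sublist l) : LAv l' :=
  ⟨fun a b c h1 => h.1 a b c (h1.trans hs), fun a b c d h1 => h.2 a b c d (h1.trans hs)⟩

theorem ldes_cons_lo (lo : ℕ) (l : List ℕ) (h : ∀ x ∈ l, lo < x) :
    ldes (lo :: l) = ldes l := by
  cases l with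
  | nil => rfl
  | cons b l =>
    have := h b (by simp)
    simp [ldes]; omega

theorem ldes_sorted (l : List ℕ) (h : l.Pairwise (· < ·)) : ldes l = 0 := by
  induction l with
  | nil => rfl
  | cons a l ih =>
    rw [List.pairwise_cons] at h
    rw [ldes_cons_lo a l h.1, ih h.2]

theorem ldes_append (lo : ℕ) (α β : List ℕ) (hα : α ≠ []) (h : ∀ x ∈ α, lo < x) :
    ldes (α ++ lo :: β) = ldes α + 1 + ldes (lo :: β) := by
  induction α with
  | nil => exact absurd rfl hα
  | cons a α ih =>
    cases α with
    | nil =>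
      have := h a (by simp)
      simp [ldes, this]
    | cons b α =>
      have := ih (by simp) (fun x hx => h x (by simp at hx ⊢; tauto))
      simp only [List.cons_append] at this ⊢
      simp only [ldes, this]; omega

theorem LAv_cons_lo (lo : ℕ) (l : List ℕ) (h : ∀ x ∈ l, lo < x) (hl : LAv l) :
    LAv (lo :: l) := by
  constructor
  · intro a b c hs h1 h2
    rw [List.sublist_cons_iff] at hs
    rcases hs with hs | ⟨r, hr, hs⟩
    · exact hl.1 a b c hs h1 h2
    · simp only [List.cons.injEq] at hr
      obtain ⟨rfl, rfl⟩ := hr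
      have := h b (hs.subset (by simp))
      omega
  · intro a b c d hs h1 h2 h3
    rw [List.sublist_cons_iff] at hs
    rcases hs with hs | ⟨r, hr, hs⟩
    · exact hl.2 a b c d hs h1 h2 h3
    · simp only [List.cons.injEq] at hr
      obtain ⟨rfl, rfl⟩ := hr
      have := h b (hs.subset (by simp))
      omega

theorem LAv_append (α β : List ℕ) (h : ∀ x ∈ α, ∀ y ∈ β, y < x) (hα : LAv α)
    (hβ : β.Pairwise (· < ·)) : LAv (α ++ β) := by
  have hβ2 : ∀ x y r, (x :: y :: r).Sublist β → x < y := by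
    intro x y r hs
    have := hβ.sublist hs
    simp at this
    exact this.1.1
  constructor
  · intro a b c hs h1 h2
    rw [List.sublist_append_iff] at hs
    obtain ⟨l1, l2, he, s1, s2⟩ := hs
    rcases l1 with _ | ⟨x1, _ | ⟨x2, _ | ⟨x3, _ | ⟨x4, l1⟩⟩⟩⟩ <;> simp at he
    · subst he
      have := hβ2 _ _ _ s2; omega
    · obtain ⟨rfl, rfl⟩ := he
      have := h a (s1.subset (by simp)) c (s2.subset (by simp)); omega
    · obtain ⟨rfl, rfl, rfl⟩ := he
      have := h a (s1.subset (by simp)) c (s2.subset (by simp)); omega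
    · obtain ⟨rfl, rfl, rfl, rfl⟩ := he
      exact hα.1 _ _ _ s1 h1 h2
  · intro a b c d hs h1 h2 h3
    rw [List.sublist_append_iff] at hs
    obtain ⟨l1, l2, he, s1, s2⟩ := hs
    rcases l1 with _ | ⟨x1, _ | ⟨x2, _ | ⟨x3, _ | ⟨x4, _ | ⟨x5, l1⟩⟩⟩⟩⟩ <;> simp at he
    · subst he
      have := hβ2 _ _ _ s2; omega
    · obtain ⟨rfl, rfl⟩ := he
      have := hβ2 c d [] ((List.sublist_cons_self b _).trans s2); omega
    · obtain ⟨rfl, rfl, rfl⟩ := he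
      have := h b (s1.subset (by simp)) d (s2.subset (by simp)); omega
    · obtain ⟨rfl, rfl, rfl, rfl⟩ := he
      have := h b (s1.subset (by simp)) d (s2.subset (by simp)); omega
    · obtain ⟨rfl, rfl, rfl, rfl, rfl⟩ := he
      exact hα.2 _ _ _ _ s1 h1 h2 h3

theorem range'_perm_split (s a b : ℕ) :
    (List.range' (s + b) a ++ List.range' s b).Perm (List.range' s (a + b)) := by
  have : List.range' s (a + b) = List.range' s b ++ List.range' (s + b) a := by
    rw [add_comm a b, List.range'_append_1]
  rw [this]
  exact List.perm_append_comm

theorem LG_mem_second {m lo d i : ℕ} (hi : i < m) {α : List ℕ}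
    (h : α ∈ LG (i + 1) (lo + (m - i)) d) :
    α ++ lo :: List.range' (lo + 1) (m - 1 - i) ∈ LG (m + 1) lo (d + 1) := by
  rw [mem_LG] at h ⊢
  obtain ⟨hp, hav, hd⟩ := h
  have hmem : ∀ x ∈ α, lo + (m - i) ≤ x := by
    intro x hx
    have := hp.subset hx
    simp [List.mem_range'_1] at this
    omega
  have e : lo :: List.range' (lo + 1) (m - 1 - i) = List.range' lo (m - i) := by
    rw [show m - i = (m - 1 - i) + 1 by omega, List.range'_succ]
  refine ⟨?_, ?_, ?_⟩
  · rw [e]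
    refine (hp.append_right _).trans ?_
    have := range'_perm_split lo (i + 1) (m - i)
    rwa [show i + 1 + (m - i) = m + 1 by omega] at this
  · rw [e]
    refine LAv_append _ _ ?_ hav List.pairwise_lt_range'
    intro x hx y hy
    have := hmem x hx
    simp [List.mem_range'_1] at hy
    omega
  · rw [ldes_append, e, hd, ldes_sorted _ List.pairwise_lt_range']
    · rintro rfl
      simpa using hp.length_eq
    · intro x hx
      have := hmem x hx
      omega

theorem LG_mem_first {m lo d : ℕ} {β : List ℕ} (h : β ∈ LG m (lo + 1) d) :
    lo :: β ∈ LG (m + 1) lo d := by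
  rw [mem_LG] at h ⊢
  obtain ⟨hp, hav, hd⟩ := h
  have hmem : ∀ x ∈ β, lo < x := by
    intro x hx
    have := hp.subset hx
    simp [List.mem_range'_1] at this
    omega
  refine ⟨?_, LAv_cons_lo _ _ hmem hav, ?_⟩
  · rw [List.range'_succ]; exact hp.cons _
  · rw [ldes_cons_lo _ _ hmem, hd]

theorem LG_split {m lo d : ℕ} {l : List ℕ} (h : l ∈ LG (m + 1) lo d) :
    (∃ β ∈ LG m (lo + 1) d, l = lo :: β) ∨
    (∃ i < m, ∃ d', d = d' + 1 ∧ ∃ α ∈ LG (i + 1) (lo + (m - i)) d',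
      l = α ++ lo :: List.range' (lo + 1) (m - 1 - i)) := by
  rw [mem_LG] at h
  obtain ⟨hp, hav, hd⟩ := h
  have hlo : lo ∈ l := hp.symm.subset (by simp)
  obtain ⟨α, β, rfl⟩ := List.append_of_mem hlo
  have hp2 : (α ++ β).Perm (List.range' (lo + 1) m) := by
    have : (lo :: (α ++ β)).Perm (lo :: List.range' (lo + 1) m) := by
      rw [← List.range'_succ]
      exact List.perm_middle.symm.trans hp
    exact this.cons_inv
  have hnd : (α ++ β).Nodup := hp2.nodup_iff.2 List.nodup_range'
  have hmem : ∀ x ∈ α ++ β, lo < x := by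
    intro x hx
    have := hp2.subset hx
    simp [List.mem_range'_1] at this
    omega
  have hmα : ∀ x ∈ α, lo < x := fun x hx => hmem x (by simp [hx])
  have hmβ : ∀ x ∈ β, lo < x := fun x hx => hmem x (by simp [hx])
  rcases eq_or_ne α [] with rfl | hα
  · left
    refine ⟨β, ?_, by simp⟩
    rw [mem_LG]
    refine ⟨by simpa using hp2, hav.sub (by simp), ?_⟩
    rw [← hd, List.nil_append, ldes_cons_lo _ _ hmβ]
  · right
    have hsep : ∀ x ∈ α, ∀ y ∈ β, y < x := by
      intro x hx y hy
      have hne : x ≠ y := fun e => (List.disjoint_of_nodup_append hnd) hx (e ▸ hy)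
      by_contra hlt
      refine hav.1 x lo y ?_ (hmα x hx) (by omega)
      exact (List.singleton_sublist.2 hx).append ((List.singleton_sublist.2 hy).cons_cons lo)
    have hβs : β.Pairwise (· < ·) := by
      rw [List.pairwise_iff_forall_sublist]
      intro x y hs
      obtain ⟨a, ha⟩ := List.exists_mem_of_ne_nil α hα
      by_contra hlt
      have hne : x ≠ y := by
        have := (List.nodup_append.1 hnd).2.1.sublist hs
        simpa using this
      refine hav.2 a lo x y ?_ (hmβ y (hs.subset (by simp))) (by omega)
        (hsep a ha x (hs.subset (by simp)))
      exact (List.singleton_sublist.2 ha).append (hs.cons_cons lo)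
    set α' := α.mergeSort (· ≤ ·) with hα'
    have hα'p : α'.Perm α := List.mergeSort_perm _ _
    have hα's : α'.Pairwise (· ≤ ·) := List.pairwise_mergeSort' _ _
    have hlen : α.length + β.length = m := by
      have := hp2.length_eq
      simpa using this
    have heq : β ++ α' = List.range' (lo + 1) m := by
      refine List.Perm.eq_of_pairwise (le := (· ≤ ·)) (fun a b _ _ h1 h2 => le_antisymm h1 h2) ?_ ?_ ?_
      · rw [List.pairwise_append]
        refine ⟨hβs.imp (fun h => le_of_lt h), hα's, ?_⟩
        intro x hx y hy
        exact (hsep y (hα'p.subset hy) x hx).le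
      · exact List.Pairwise.imp (fun h => le_of_lt h) (List.pairwise_lt_range' (s := lo + 1) (n := m))
      · exact (List.perm_append_comm.trans (hα'p.append_right _)).trans hp2
    have hsplit : List.range' (lo + 1) m =
        List.range' (lo + 1) β.length ++ List.range' (lo + 1 + β.length) α.length := by
      rw [List.range'_append_1, add_comm β.length, hlen]
    rw [hsplit] at heq
    obtain ⟨hb, ha⟩ := List.append_inj heq (by simp)
    have hα0 : 0 < α.length := List.length_pos_iff.2 hα
    refine ⟨α.length - 1, by omega, ldes α, ?_, α, ?_, ?_⟩
    · rw [← hd, ldes_append _ _ _ hα hmα, ldes_cons_lo _ _ hmβ, ldes_sorted _ hβs]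
    · rw [mem_LG]
      refine ⟨?_, hav.sub (by simp), rfl⟩
      rw [show lo + (m - (α.length - 1)) = lo + 1 + β.length by omega,
        show α.length - 1 + 1 = α.length by omega, ← ha]
      exact hα'p.symm
    · rw [show m - 1 - (α.length - 1) = β.length by omega, ← hb]

theorem LG_zero_zero (lo : ℕ) : LG 0 lo 0 = {[]} := by
  ext l
  rw [mem_LG]
  simp only [List.range'_zero, List.perm_nil, Finset.mem_singleton]
  constructor
  · exact fun h => h.1
  · rintro rfl
    exact ⟨rfl, ⟨by simp, by simp⟩, rfl⟩

theorem LG_zero_succ (lo d : ℕ) : LG 0 lo (d + 1) = ∅ := by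
  ext l
  rw [mem_LG]
  simp only [List.range'_zero, List.perm_nil, Finset.notMem_empty, iff_false]
  rintro ⟨rfl, -, h⟩
  simp [ldes] at h

theorem LG_card_zero (m lo : ℕ) : (LG m lo 0).card = 1 := by
  induction m generalizing lo with
  | zero => simp [LG_zero_zero]
  | succ m ih =>
    refine Eq.trans ?_ (ih (lo + 1))
    symm
    refine Finset.card_bij (fun β _ => lo :: β) (fun β h => LG_mem_first h) ?_ ?_
    · intro a _ b _ h
      exact (List.cons.inj h).2
    · intro l hl
      rcases LG_split hl with ⟨β, h, he⟩ | ⟨i, _, d', h, _⟩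
      · exact ⟨β, h, he.symm⟩
      · omega

theorem LG_card_rec (m lo d : ℕ) : (LG (m + 1) lo (d + 1)).card =
    (LG m (lo + 1) (d + 1)).card +
      ∑ i ∈ Finset.range m, (LG (i + 1) (lo + (m - i)) d).card := by
  classical
  have hS : LG (m + 1) lo (d + 1) = (LG m (lo + 1) (d + 1)).image (fun β => lo :: β) ∪
      (Finset.range m).biUnion (fun i => (LG (i + 1) (lo + (m - i)) d).image
        (fun α => α ++ lo :: List.range' (lo + 1) (m - 1 - i))) := by
    ext l
    simp only [Finset.mem_union, Finset.mem_image, Finset.mem_biUnion, Finset.mem_range]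
    constructor
    · intro h
      rcases LG_split h with ⟨β, hβ, rfl⟩ | ⟨i, hi, d', h, α, hα, rfl⟩
      · exact Or.inl ⟨β, hβ, rfl⟩
      · obtain rfl : d = d' := by omega
        exact Or.inr ⟨i, hi, α, hα, rfl⟩
    · rintro (⟨β, h, rfl⟩ | ⟨i, hi, α, hα, rfl⟩)
      · exact LG_mem_first h
      · exact LG_mem_second hi hα
  rw [hS, Finset.card_union_of_disjoint, Finset.card_biUnion]
  · congr 1
    · exact Finset.card_image_of_injective _ (fun a b h => by simpa using h)
    · refine Finset.sum_congr rfl (fun i _ => ?_)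
      exact Finset.card_image_of_injective _ (fun a b h => by simpa using h)
  · intro i hi j hj hij
    rw [Function.onFun]
    rw [Finset.disjoint_left]
    simp only [Finset.mem_image, not_exists, not_and]
    rintro _ ⟨α, hα, rfl⟩ α' hα' he
    rw [mem_LG] at hα hα'
    have h1 : lo ∉ α := fun h => by
      have := hα.1.subset h
      simp [List.mem_range'_1] at this hi
      omega
    have h2 : lo ∉ α' := fun h => by
      have := hα'.1.subset h
      simp [List.mem_range'_1] at this hj
      omega
    have l1 := hα.1.length_eq
    have l2 := hα'.1.length_eq
    simp at l1 l2
    have := congrArg (List.idxOf lo) he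
    rw [List.idxOf_append_of_notMem h1, List.idxOf_append_of_notMem h2] at this
    simp at this
    omega
  · rw [Finset.disjoint_left]
    simp only [Finset.mem_image, Finset.mem_biUnion, not_exists, not_and, Finset.mem_range]
    rintro _ ⟨β, hβ, rfl⟩ i hi α hα he
    rw [mem_LG] at hα
    cases α with
    | nil => simpa using hα.1.length_eq
    | cons a α =>
      simp at he
      have := hα.1.subset (List.mem_cons_self)
      simp [List.mem_range'_1] at this
      omega

theorem sum_choose_aux (m d : ℕ) :
    ∑ i ∈ Finset.range m, (i + d).choose (2 * d) = (m + d).choose (2 * d + 1) := by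
  induction m with
  | zero => simp; rw [Nat.choose_eq_zero_of_lt]; omega
  | succ m ih =>
    rw [Finset.sum_range_succ, ih, show m + 1 + d = (m + d) + 1 by ring,
      Nat.choose_succ_succ (m + d) (2 * d)]
    ring

theorem LG_card (d m lo : ℕ) : (LG (m + 1) lo d).card = (m + d).choose (2 * d) := by
  induction d generalizing m lo with
  | zero => simp [LG_card_zero]
  | succ d ihd =>
    induction m generalizing lo with
    | zero =>
      rw [LG_card_rec, LG_zero_succ]
      simp
      rw [Nat.choose_eq_zero_of_lt]; omega
    | succ m ihm =>
      rw [LG_card_rec, ihm]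
      simp only [ihd]
      rw [sum_choose_aux, show m + 1 + (d + 1) = (m + 1 + d) + 1 by ring,
        show 2 * (d + 1) = (2 * d + 1) + 1 by ring, Nat.choose_succ_succ (m + 1 + d) (2 * d + 1),
        show m + (d + 1) = m + 1 + d by ring]
      ring

theorem sublist_ofFn_iff' {m : ℕ} (g : Fin m → ℕ) (l : List ℕ) :
    l.Sublist (List.ofFn g) ↔ ∃ l' : List (Fin m), l'.Pairwise (· < ·) ∧ l = l'.map g := by
  rw [List.ofFn_eq_map, List.sublist_map_iff]
  constructor
  · rintro ⟨l', h, rfl⟩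
    exact ⟨l', (List.pairwise_lt_finRange m).sublist h, rfl⟩
  · rintro ⟨l', h, rfl⟩
    refine ⟨l', ?_, rfl⟩
    refine List.sublist_of_subperm_of_pairwise (r := (· < ·)) ?_ h (List.pairwise_lt_finRange m)
    exact List.subperm_of_subset (h.imp (fun h => ne_of_lt h)) (fun x _ => List.mem_finRange x)

theorem LAv_ofFn_iff {m : ℕ} (g : Fin m → ℕ) :
    LAv (List.ofFn g) ↔
      (∀ i j k, i < j → j < k → g j < g i → g i < g k → False) ∧
      (∀ i j k l, i < j → j < k → k < l → g j < g l → g l < g k → g k < g i → False) := by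
  unfold LAv
  simp only [sublist_ofFn_iff']
  constructor
  · rintro ⟨h1, h2⟩
    constructor
    · intro i j k hij hjk
      refine h1 _ _ _ ⟨[i, j, k], ?_, rfl⟩
      simp [hij, hjk, hij.trans hjk]
    · intro i j k l hij hjk hkl
      refine h2 _ _ _ _ ⟨[i, j, k, l], ?_, rfl⟩
      simp [hij, hjk, hkl, hij.trans hjk, hjk.trans hkl, (hij.trans hjk).trans hkl]
  · rintro ⟨h1, h2⟩
    constructor
    · rintro a b c ⟨l', hp, he⟩
      rcases l' with _ | ⟨x1, _ | ⟨x2, _ | ⟨x3, _ | ⟨x4, l1⟩⟩⟩⟩ <;> simp at he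
      obtain ⟨rfl, rfl, rfl⟩ := he
      simp at hp
      exact h1 _ _ _ hp.1.1 hp.2
    · rintro a b c d ⟨l', hp, he⟩
      rcases l' with _ | ⟨x1, _ | ⟨x2, _ | ⟨x3, _ | ⟨x4, _ | ⟨x5, l1⟩⟩⟩⟩⟩ <;> simp at he
      obtain ⟨rfl, rfl, rfl, rfl⟩ := he
      simp at hp
      exact h2 _ _ _ _ hp.1.1 hp.2.1.1 hp.2.2

/-- The list of values of `τ` after the first. -/
def tailList {m : ℕ} (τ : Fin (m + 1) → Fin (m + 1)) : List ℕ :=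
  List.ofFn fun i : Fin m => (τ i.succ : ℕ)

theorem cycContains_iff {n : ℕ} (τ : Fin n → Fin n) :
    CycContains τ ![1, 3, 2, 4] ↔ ∃ r a b c d : Fin n, a < b ∧ b < c ∧ c < d ∧
      τ (a + r) < τ (c + r) ∧ τ (c + r) < τ (b + r) ∧ τ (b + r) < τ (d + r) := by
  unfold CycContains ContainsPat rotSeq
  refine exists_congr fun r => ?_
  constructor
  · rintro ⟨f, hf, h⟩
    refine ⟨f 0, f 1, f 2, f 3, hf (by decide), hf (by decide), hf (by decide), ?_, ?_, ?_⟩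
    · exact (h 0 2).1 (by decide)
    · exact (h 2 1).1 (by decide)
    · exact (h 1 3).1 (by decide)
  · rintro ⟨a, b, c, d, hab, hbc, hcd, h1, h2, h3⟩
    refine ⟨![a, b, c, d], ?_, ?_⟩
    · rw [Fin.strictMono_iff_lt_succ]
      intro i
      fin_cases i <;> simpa
    · intro i j
      fin_cases i <;> fin_cases j <;> simp <;> order

theorem cycAvoids_iff {m : ℕ} (τ : Fin (m + 1) → Fin (m + 1)) (h0 : τ 0 = 0)
    (hinj : Function.Injective τ) :
    CycAvoids τ ![1, 3, 2, 4] ↔ LAv (tailList τ) := by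
  unfold CycAvoids tailList
  rw [LAv_ofFn_iff, cycContains_iff]
  simp only [Fin.val_fin_lt]
  have hne : ∀ p q, τ p < τ q → ∃ i : Fin m, i.succ = q := by
    intro p q h
    refine Fin.exists_succ_eq.2 ?_
    rintro rfl
    rw [h0] at h
    exact absurd h (by simp)
  constructor
  · intro H
    constructor
    · intro i j k hij hjk h1 h2
      refine H ⟨0, 0, i.succ, j.succ, k.succ, by simp, by simpa, by simpa, ?_, ?_, ?_⟩
      · simp only [add_zero, h0]
        rw [Fin.pos_iff_ne_zero]
        intro h
        exact Fin.succ_ne_zero j (hinj (h.trans h0.symm))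
      · simpa
      · simpa
    · intro i j k l hij hjk hkl h1 h2 h3
      have e : ∀ x : Fin (m + 1), x - j.succ + j.succ = x := fun x => by simp
      have v : ∀ x : Fin (m + 1), (x - j.succ : Fin (m + 1)).val =
          if j.val + 1 ≤ x.val then x.val - (j.val + 1) else m + 1 + x.val - (j.val + 1) := by
        intro x
        have h1 := congrArg Fin.val (e x)
        rw [Fin.val_add_eq_ite] at h1
        have := (x - j.succ).isLt
        have := x.isLt
        simp only [Fin.val_succ] at h1
        split_ifs at h1 ⊢ <;> omega
      refine H ⟨j.succ, j.succ - j.succ, k.succ - j.succ, l.succ - j.succ, i.succ - j.succ,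
        ?_, ?_, ?_, ?_, ?_, ?_⟩
      · rw [Fin.lt_def, v, v]; simp only [Fin.val_succ]; split_ifs <;> omega
      · rw [Fin.lt_def, v, v]; simp only [Fin.val_succ]; split_ifs <;> omega
      · rw [Fin.lt_def, v, v]; simp only [Fin.val_succ]; split_ifs <;> omega
      · rw [e, e]; exact h1
      · rw [e, e]; exact h2
      · rw [e, e]; exact h3
  · rintro ⟨H1, H2⟩ ⟨r, a, b, c, d, hab, hbc, hcd, h1, h2, h3⟩
    have key : ((b + r < c + r ∧ c + r < d + r) ∨
        (d + r < a + r ∧ a + r < b + r ∧ b + r < c + r)) ∨ (c + r < a + r ∧ a + r < b + r) := by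
      simp only [Fin.lt_def, Fin.val_add_eq_ite] at *
      have := a.isLt
      have := b.isLt
      have := c.isLt
      have := d.isLt
      have := r.isLt
      split_ifs <;> omega
    generalize a + r = p at *
    generalize b + r = q at *
    generalize c + r = s at *
    generalize d + r = t at *
    obtain ⟨s, rfl⟩ := hne _ _ h1
    obtain ⟨q, rfl⟩ := hne _ _ h2
    obtain ⟨t, rfl⟩ := hne _ _ h3
    rcases key with (⟨k1, k2⟩ | ⟨k1, k2, k3⟩) | ⟨k1, k2⟩
    · exact H1 q s t (by simpa using k1) (by simpa using k2) h2 h3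
    · obtain ⟨p, rfl⟩ := Fin.exists_succ_eq.2 (Fin.ne_zero_of_lt k1)
      exact H2 t p q s (by simpa using k1) (by simpa using k2) (by simpa using k3) h1 h2 h3
    · obtain ⟨p, rfl⟩ := Fin.exists_succ_eq.2 (Fin.ne_zero_of_lt k1)
      exact H1 s p q (by simpa using k1) (by simpa using k2) h1 h2

theorem ldes_ofFn (p : ℕ) (g : Fin (p + 1) → ℕ) :
    ldes (List.ofFn g) = ∑ i : Fin p, if g i.succ < g i.castSucc then 1 else 0 := by
  induction p with
  | zero => simp [ldes]
  | succ p ih =>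
    have := ih (fun i => g i.succ)
    rw [List.ofFn_succ] at this
    rw [List.ofFn_succ, List.ofFn_succ, ldes, this, Fin.sum_univ_succ]
    rfl

theorem cdes_eq_sum {n : ℕ} (τ : Fin (n + 1) → Fin (n + 1)) :
    cdes τ = ∑ i : Fin (n + 1), if τ (i + 1) < τ i then 1 else 0 := by
  unfold cdes
  rw [Finset.card_filter]
  refine Finset.sum_congr rfl fun i _ => ?_
  have : (⟨(↑i + 1) % (n + 1), Nat.mod_lt _ i.pos⟩ : Fin (n + 1)) = i + 1 := by
    ext
    simp [Fin.val_add]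
  rw [this]

theorem cdes_tail {p : ℕ} (τ : Fin (p + 2) → Fin (p + 2)) (h0 : τ 0 = 0)
    (hinj : Function.Injective τ) : cdes τ = ldes (tailList τ) + 1 := by
  rw [cdes_eq_sum, tailList, ldes_ofFn, Fin.sum_univ_castSucc, Fin.sum_univ_succ]
  have hl : τ (Fin.last (p + 1) + 1) < τ (Fin.last (p + 1)) := by
    rw [Fin.last_add_one, h0, Fin.pos_iff_ne_zero]
    intro h
    exact absurd (hinj (h.trans h0.symm)) (Fin.last_pos.ne')
  have hf : ¬ (τ ((0 : Fin (p + 1)).castSucc + 1) < τ (0 : Fin (p + 1)).castSucc) := by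
    simp [h0]
  rw [if_pos hl, if_neg hf, zero_add]
  congr 1
  refine Finset.sum_congr rfl fun i _ => ?_
  simp only [Fin.val_fin_lt, Fin.coeSucc_eq_succ, Fin.succ_castSucc]

theorem rotSeq_rotSeq {n : ℕ} (σ : Fin (n + 1) → Fin (n + 1)) (r s : Fin (n + 1)) :
    rotSeq (rotSeq σ r) s = rotSeq σ (s + r) := by
  funext i
  simp [rotSeq, add_assoc]

theorem cycClass_rot {n : ℕ} (σ : Fin (n + 1) → Fin (n + 1)) (r : Fin (n + 1)) :
    CycClass (rotSeq σ r) = CycClass σ := by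
  ext x
  simp only [CycClass, Set.mem_range, rotSeq_rotSeq]
  constructor
  · rintro ⟨s, rfl⟩
    exact ⟨_, rfl⟩
  · rintro ⟨s, rfl⟩
    exact ⟨s - r, by simp⟩

theorem cycAvoids_rot {n k : ℕ} (σ : Fin (n + 1) → Fin (n + 1)) (r : Fin (n + 1))
    (π : Fin k → ℕ) : CycAvoids (rotSeq σ r) π ↔ CycAvoids σ π := by
  unfold CycAvoids CycContains
  simp only [rotSeq_rotSeq]
  refine not_congr ⟨?_, ?_⟩
  · rintro ⟨s, h⟩
    exact ⟨_, h⟩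
  · rintro ⟨s, h⟩
    exact ⟨s - r, by simpa using h⟩

theorem cdes_rot {n : ℕ} (σ : Fin (n + 1) → Fin (n + 1)) (r : Fin (n + 1)) :
    cdes (rotSeq σ r) = cdes σ := by
  rw [cdes_eq_sum, cdes_eq_sum]
  refine Fintype.sum_equiv (Equiv.addRight r) _ _ fun i => ?_
  have e1 : rotSeq σ r (i + 1) = σ (i + r + 1) := by
    rw [rotSeq, add_right_comm]
  have e2 : rotSeq σ r i = σ (i + r) := rfl
  rw [e1, e2]
  rfl

theorem tail_perm {m : ℕ} (τ : Fin (m + 1) → Fin (m + 1)) (h0 : τ 0 = 0)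
    (hinj : Function.Injective τ) : (tailList τ).Perm (List.range' 1 m) := by
  have hnd : (tailList τ).Nodup := by
    rw [tailList, List.nodup_ofFn]
    intro i j h
    exact Fin.succ_injective _ (hinj (Fin.ext h))
  refine (List.subperm_of_subset hnd ?_).perm_of_length_le (by simp [tailList])
  intro x hx
  rw [tailList, List.mem_ofFn] at hx
  obtain ⟨i, rfl⟩ := hx
  rw [List.mem_range'_1]
  have h1 : (τ i.succ).val ≠ 0 := fun h =>
    Fin.succ_ne_zero i (hinj ((Fin.ext h : τ i.succ = 0).trans h0.symm))
  have := (τ i.succ).isLt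
  omega

/-- Normalised representatives. -/
def NormSet (p k : ℕ) : Set (Fin (p + 2) → Fin (p + 2)) :=
  {τ | Function.Injective τ ∧ τ 0 = 0 ∧ CycAvoids τ ![1, 3, 2, 4] ∧ cdes τ = k}

theorem avClasses_eq_image (p k : ℕ) :
    (AvClasses (p + 2) fun σ => CycAvoids σ ![1, 3, 2, 4] ∧ cdes σ = k) =
      CycClass '' NormSet p k := by
  ext C
  constructor
  · rintro ⟨σ, rfl, ha, hd⟩
    refine ⟨rotSeq σ (σ.symm 0), ⟨?_, ?_, ?_, ?_⟩, cycClass_rot _ _⟩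
    · intro i j h
      simpa [rotSeq] using h
    · simp [rotSeq]
    · rwa [cycAvoids_rot]
    · rwa [cdes_rot]
  · rintro ⟨τ, ⟨hi, h0, ha, hd⟩, rfl⟩
    exact ⟨Equiv.ofBijective τ (Finite.injective_iff_bijective.1 hi), rfl, ha, hd⟩

theorem cycClass_injOn (p k : ℕ) : Set.InjOn CycClass (NormSet p k) := by
  rintro τ ⟨hi, h0, -, -⟩ τ' ⟨hi', h0', -, -⟩ h
  have : τ' ∈ CycClass τ := by
    rw [h]
    exact ⟨0, by funext i; simp [rotSeq]⟩
  obtain ⟨r, rfl⟩ := this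
  have : r = 0 := by
    apply hi
    rw [h0, ← h0']
    simp [rotSeq]
  subst this
  funext i
  simp [rotSeq]

theorem tailList_injOn (p k : ℕ) : Set.InjOn tailList (NormSet p k) := by
  rintro τ ⟨hi, h0, -, -⟩ τ' ⟨hi', h0', -, -⟩ h
  have h2 := List.ofFn_injective h
  funext i
  refine Fin.cases ?_ (fun i => ?_) i
  · rw [h0, h0']
  · exact Fin.ext (congrFun h2 i)

theorem tailList_image (p d : ℕ) :
    tailList '' NormSet p (d + 1) = (LG (p + 1) 1 d : Set (List ℕ)) := by
  ext l
  simp only [Finset.mem_coe, mem_LG]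
  constructor
  · rintro ⟨τ, ⟨hi, h0, ha, hd⟩, rfl⟩
    refine ⟨tail_perm τ h0 hi, (cycAvoids_iff τ h0 hi).1 ha, ?_⟩
    rw [cdes_tail τ h0 hi] at hd
    omega
  · rintro ⟨hp, ha, hd⟩
    have hlen : l.length = p + 1 := by simpa using hp.length_eq
    have hmem : ∀ x ∈ l, 1 ≤ x ∧ x < p + 2 := by
      intro x hx
      have := hp.subset hx
      rw [List.mem_range'_1] at this
      omega
    have hnd : l.Nodup := hp.nodup_iff.2 List.nodup_range'
    let g : Fin (p + 1) → Fin (p + 2) := fun i =>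
      ⟨l[i.val]'(by omega), (hmem _ (List.getElem_mem _)).2⟩
    let τ : Fin (p + 2) → Fin (p + 2) := Fin.cons 0 g
    have h0 : τ 0 = 0 := rfl
    have hi : Function.Injective τ := by
      rw [Fin.cons_injective_iff]
      constructor
      · rintro ⟨i, h⟩
        have := (hmem (l[i.val]'(by omega)) (List.getElem_mem _)).1
        have h2 := congrArg Fin.val h
        simp [g] at h2
        omega
      · intro i j h
        have h2 := congrArg Fin.val h
        simp only [g] at h2
        exact Fin.ext ((hnd.getElem_inj_iff).1 h2)
    have ht : tailList τ = l := by
      apply List.ext_getElem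
      · simp [tailList, hlen]
      · intro i h1 h2
        simp only [tailList, List.getElem_ofFn]
        rfl
    refine ⟨τ, ⟨hi, h0, ?_, ?_⟩, ht⟩
    · rw [cycAvoids_iff τ h0 hi, ht]; exact ha
    · rw [cdes_tail τ h0 hi, ht, hd]

/-- For `n ≥ 2` and `1 ≤ k ≤ n-1`, the number of cyclic permutations of length `n`
avoiding `[1324]` with exactly `k` cyclic descents is `binom(n+k-3, n-k-1)`
(the coefficient form of `D_n([1324]; q) = Σ_k binom(n+k-3, n-k-1) q^k`). -/
theorem cdes_poly_av_1324 (n k : ℕ) (hn : 2 ≤ n) (hk1 : 1 ≤ k) (hk2 : k ≤ n - 1) :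
    (AvClasses n fun σ => CycAvoids σ ![1,3,2,4] ∧ cdes σ = k).ncard
      = Nat.choose (n + k - 3) (n - k - 1) := by
  obtain ⟨p, rfl⟩ : ∃ p, n = p + 2 := ⟨n - 2, by omega⟩
  obtain ⟨d, rfl⟩ : ∃ d, k = d + 1 := ⟨k - 1, by omega⟩
  rw [avClasses_eq_image, Set.InjOn.ncard_image (cycClass_injOn _ _),
    ← Set.InjOn.ncard_image (tailList_injOn _ _), tailList_image, Set.ncard_coe_finset,
    LG_card, show p + 2 + (d + 1) - 3 = p + d by omega,
    show p + 2 - (d + 1) - 1 = p - d by omega]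
  rw [← Nat.choose_symm (by omega : 2 * d ≤ p + d)]
  congr 1
  omega
end

section
/- For every integer n ≥ 1, the number of cyclic permutations of length n avoiding the vincular cyclic pattern [13\overline{24}] equals the Catalan number C_{n−1} = (1/n) · binom(2(n−1), n−1). -/
/-- The cyclic permutation `[σ]` contains the vincular cyclic pattern `[13-24bar]`:
some rotation of `σ` has a subsequence order isomorphic to `1324` in which the
entries playing the roles of `2` and `4` (the third and fourth entries of the
occurrence) occupy adjacent positions in that rotation. -/
def CycContainsVinc1324bar {n : ℕ} (σ : Fin n → Fin n) : Prop :=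
  ∃ r : Fin n, ∃ f : Fin 4 → Fin n, StrictMono f ∧ ((f 3 : ℕ) = (f 2 : ℕ) + 1) ∧
    ∀ i j : Fin 4, (![1,3,2,4] : Fin 4 → ℕ) i < (![1,3,2,4] : Fin 4 → ℕ) j ↔
      rotSeq σ r (f i) < rotSeq σ r (f j)

namespace Vinc

/-- Avoidance of the classical pattern 213, for lists. -/
def Av : List ℕ → Prop
  | [] => True
  | x :: l => l.Pairwise (fun a c => ¬ (a < x ∧ x < c)) ∧ Av l

theorem av_iff (l : List ℕ) : Av l ↔ ∀ (i j k : ℕ) (hij : i < j) (hjk : j < k)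
    (hk : k < l.length), ¬ (l[j] < l[i] ∧ l[i] < l[k]) := by
  induction l with
  | nil => simp [Av]
  | cons x l ih =>
    simp only [Av, ih, List.pairwise_iff_getElem]
    constructor
    · rintro ⟨h1, h2⟩ i j k hij hjk hk
      obtain ⟨j, rfl⟩ : ∃ j', j = j' + 1 := ⟨j - 1, by omega⟩
      obtain ⟨k, rfl⟩ : ∃ k', k = k' + 1 := ⟨k - 1, by omega⟩
      simp only [List.length_cons] at hk
      cases i with
      | zero => simpa using h1 j k (by omega) (by omega) (by omega)
      | succ i => simpa using h2 i j k (by omega) (by omega) (by omega)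
    · intro h
      constructor
      · intro i j hi hj hij
        exact h 0 (i+1) (j+1) (by omega) (by omega) (by simpa using hj)
      · intro i j k hij hjk hk
        exact h (i+1) (j+1) (k+1) (by omega) (by omega) (by simpa using hk)

theorem pw_of (l : List ℕ) (P : ℕ → ℕ → Prop) (h : ∀ a ∈ l, ∀ b ∈ l, P a b) :
    l.Pairwise P := by
  rw [List.pairwise_iff_getElem]
  intro i j hi hj _
  exact h _ (List.getElem_mem _) _ (List.getElem_mem _)

theorem av_split {L R : List ℕ} {k : ℕ} (h : Av (L ++ k :: R)) :
    Av L ∧ Av R ∧ ∀ x ∈ L, ∀ y ∈ R, k < x → y ≤ x := by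
  induction L with
  | nil => simpa [Av] using h.2
  | cons a L ih =>
    simp only [List.cons_append, Av] at h
    obtain ⟨h1, h2⟩ := h
    obtain ⟨i1, i2, i3⟩ := ih h2
    rw [List.pairwise_append] at h1
    refine ⟨⟨h1.1, i1⟩, i2, ?_⟩
    intro x hx y hy hk
    rcases List.mem_cons.1 hx with rfl | hx
    · have := (List.pairwise_cons.1 h1.2.1).1 y hy
      by_contra hc
      exact this ⟨hk, by omega⟩
    · exact i3 x hx y hy hk

theorem av_join {L R : List ℕ} {k : ℕ} (hL : Av L) (hR : Av R)
    (h : ∀ x ∈ L, ∀ y ∈ R, y < x) (hk : ∀ x ∈ L, k < x) (hk' : ∀ y ∈ R, k < y) :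
    Av (L ++ k :: R) := by
  induction L with
  | nil =>
    refine ⟨?_, hR⟩
    refine pw_of _ _ ?_
    intro a ha c hc
    have := hk' a ha
    omega
  | cons a L ih =>
    refine ⟨?_, ih hL.2 (fun x hx => h x (by simp [hx])) (fun x hx => hk x (by simp [hx]))⟩
    have ha : ∀ y ∈ k :: R, y < a := by
      intro y hy
      rcases List.mem_cons.1 hy with rfl | hy
      · exact hk a (by simp)
      · exact h a (by simp) y hy
    refine List.pairwise_append.2 ⟨hL.1, ?_, ?_⟩
    · refine pw_of _ _ ?_
      intro b hb c hc
      have := ha c hc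
      omega
    · intro b hb c hc
      have := ha c hc
      omega

/-- The 213-avoiding word on the interval starting at `k` coded by a binary tree. -/
def T : BinaryTree Unit → ℕ → List ℕ
  | .nil, _ => []
  | .node _ l r, k => T l (k + 1 + r.numNodes) ++ k :: T r (k + 1)

theorem T_length (t : BinaryTree Unit) (k : ℕ) : (T t k).length = t.numNodes := by
  induction t generalizing k with
  | nil => simp [T, BinaryTree.numNodes]
  | node _ l r h1 h2 => simp [T, BinaryTree.numNodes, h1, h2]; omega

theorem T_mem (t : BinaryTree Unit) (k x : ℕ) : x ∈ T t k ↔ k ≤ x ∧ x < k + t.numNodes := by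
  induction t generalizing k with
  | nil => simp [T, BinaryTree.numNodes]
  | node _ l r h1 h2 => simp [T, BinaryTree.numNodes, h1, h2]; omega

theorem T_nodup (t : BinaryTree Unit) (k : ℕ) : (T t k).Nodup := by
  induction t generalizing k with
  | nil => simp [T]
  | node _ l r h1 h2 =>
    simp only [T, List.nodup_append, List.nodup_cons, h1, h2, T_mem, List.mem_cons]
    refine ⟨trivial, ⟨by omega, trivial⟩, ?_⟩
    intro a ha b hb
    omega

theorem T_av (t : BinaryTree Unit) (k : ℕ) : Av (T t k) := by
  induction t generalizing k with
  | nil => simp [T, Av]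
  | node _ l r h1 h2 =>
    refine av_join (h1 _) (h2 _) ?_ ?_ ?_ <;> simp only [T_mem]
    · intro x hx y hy; omega
    · intro x hx; omega
    · intro x hx; omega

theorem T_inj (t t' : BinaryTree Unit) (k : ℕ) (h : T t k = T t' k) : t = t' := by
  induction t generalizing k t' with
  | nil =>
    cases t' with
    | nil => rfl
    | node _ l r => simp [T] at h
  | node _ l r h1 h2 =>
    cases t' with
    | nil => simp [T] at h
    | node _ l' r' =>
      simp only [T] at h
      rw [List.append_cons_inj_of_notMem (by simp only [T_mem]; omega)
        (by simp only [T_mem]; omega)] at h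
      have hr := h2 _ _ h.2.2
      subst hr
      have hl := h1 _ _ h.1
      subst hl
      rfl

theorem interval_of_down (S : Finset ℕ) (k : ℕ) (h1 : ∀ x ∈ S, k ≤ x)
    (h2 : ∀ x ∈ S, ∀ y, k ≤ y → y < x → y ∈ S) : S = Finset.Ico k (k + S.card) := by
  apply Finset.eq_of_subset_of_card_le
  · intro x hx
    have hs : Finset.Ico k (x + 1) ⊆ S := by
      intro y hy
      rw [Finset.mem_Ico] at hy
      rcases Nat.lt_or_ge y x with h | h
      · exact h2 x hx y hy.1 h
      · have : y = x := by omega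
        exact this ▸ hx
    have := Finset.card_le_card hs
    rw [Nat.card_Ico] at this
    have := h1 x hx
    rw [Finset.mem_Ico]
    omega
  · simp

theorem T_surj (m : ℕ) : ∀ (l : List ℕ) (k : ℕ), l.length = m → l.Nodup →
    (∀ x, x ∈ l ↔ k ≤ x ∧ x < k + l.length) → Av l → ∃ t, T t k = l := by
  induction m using Nat.strong_induction_on with
  | _ m ih =>
    intro l k hm hnd hmem hav
    rcases Nat.eq_zero_or_pos m with h0 | hpos
    · refine ⟨.nil, ?_⟩
      have : l = [] := List.length_eq_zero_iff.1 (by omega)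
      simp [T, this]
    · have hk : k ∈ l := (hmem k).2 (by omega)
      obtain ⟨L, R, rfl⟩ := List.append_of_mem hk
      obtain ⟨a1, a2, a3⟩ := av_split hav
      simp only [List.nodup_append, List.nodup_cons, List.mem_cons] at hnd
      obtain ⟨n1, ⟨n2, n3⟩, n4⟩ := hnd
      simp only [List.mem_append, List.mem_cons, List.length_append, List.length_cons] at hmem hm
      have hLk : ∀ x ∈ L, k < x := by
        intro x hx
        have := (hmem x).1 (Or.inl hx)
        have := n4 x hx k (Or.inl rfl)
        omega
      have hRk : ∀ x ∈ R, k < x := by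
        intro x hx
        have := (hmem x).1 (Or.inr (Or.inr hx))
        have : x ≠ k := fun h => n2 (h ▸ hx)
        omega
      have hLR : ∀ x ∈ L, ∀ y ∈ R, y < x := by
        intro x hx y hy
        have := a3 x hx y hy (hLk x hx)
        have := n4 x hx y (Or.inr hy)
        omega
      have hS := interval_of_down R.toFinset (k + 1)
        (by intro x hx; exact hRk x (by simpa using hx))
        (by
          intro x hx y hy hyx
          rw [List.mem_toFinset] at hx ⊢
          have := (hmem x).1 (Or.inr (Or.inr hx))
          rcases (hmem y).2 (by omega) with h | h | h
          · have := hLR y h x hx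
            omega
          · omega
          · exact h)
      rw [List.toFinset_card_of_nodup n3] at hS
      have hRm : ∀ x, x ∈ R ↔ k + 1 ≤ x ∧ x < k + 1 + R.length := by
        intro x
        rw [← List.mem_toFinset, hS, Finset.mem_Ico]
      have hLm : ∀ x, x ∈ L ↔ k + 1 + R.length ≤ x ∧ x < k + 1 + R.length + L.length := by
        intro x
        constructor
        · intro hx
          have h1 := (hmem x).1 (Or.inl hx)
          have h2 := hLk x hx
          have h3 : x ∉ R := fun h => absurd (hLR x hx x h) (lt_irrefl _)
          rw [hRm] at h3
          omega
        · intro hx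
          rcases (hmem x).2 (by omega) with h | h | h
          · exact h
          · omega
          · rw [hRm] at h
            omega
      obtain ⟨r, hr⟩ := ih R.length (by omega) R (k + 1) rfl n3 hRm a2
      have hrl : r.numNodes = R.length := by rw [← hr, T_length]
      obtain ⟨t, ht⟩ := ih L.length (by omega) L (k + 1 + R.length) rfl n1 hLm a1
      exact ⟨.node () t r, by simp only [T]; rw [hrl, ht, hr]⟩

/-- Normalized permutations avoiding 213. -/
def S (m : ℕ) : Set (Equiv.Perm (Fin (m + 1))) :=
  {σ | σ 0 = 0 ∧ ∀ i j k, i < j → j < k → ¬ (σ j < σ i ∧ σ i < σ k)}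

/-- The word of a permutation. -/
def word {m : ℕ} (σ : Equiv.Perm (Fin (m + 1))) : List ℕ := List.ofFn fun i => (σ i : ℕ)

theorem word_inj {m : ℕ} : Function.Injective (word (m := m)) := by
  intro σ τ h
  have := List.ofFn_injective h
  ext i
  exact congrFun this i

theorem word_av {m : ℕ} (σ : Equiv.Perm (Fin (m + 1))) :
    Av (word σ) ↔ ∀ i j k, i < j → j < k → ¬ (σ j < σ i ∧ σ i < σ k) := by
  rw [av_iff]
  simp only [word, List.length_ofFn, List.getElem_ofFn]
  constructor
  · intro h i j k hij hjk
    exact h i j k hij hjk k.2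
  · intro h i j k hij hjk hk
    exact h ⟨i, by omega⟩ ⟨j, by omega⟩ ⟨k, hk⟩ hij hjk

theorem av_cons_zero (l : List ℕ) : Av (0 :: l) ↔ Av l := by
  simp only [Av]
  constructor
  · exact fun h => h.2
  · intro h
    exact ⟨pw_of _ _ (by intro a _ b _; omega), h⟩

theorem image_word (m : ℕ) :
    word '' (S m) = (fun t => 0 :: T t 1) '' (BinaryTree.treesOfNumNodesEq m : Set (BinaryTree Unit)) := by
  ext l
  constructor
  · rintro ⟨σ, ⟨h0, hav⟩, rfl⟩
    have hw : word σ = 0 :: (word σ).tail := by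
      simp [word, List.ofFn_succ, h0]
    have hlen : (word σ).tail.length = m := by simp [word]
    have hnd : (word σ).Nodup := by
      rw [word, List.nodup_ofFn]
      intro a b h
      exact σ.injective (Fin.ext h)
    have hmem : ∀ x, x ∈ word σ ↔ x < m + 1 := by
      intro x
      simp only [word, List.mem_ofFn]
      constructor
      · rintro ⟨i, rfl⟩
        exact (σ i).2
      · intro h
        exact ⟨σ.symm ⟨x, h⟩, by simp⟩
    have hA := (word_av σ).2 hav
    generalize (word σ).tail = w at hw hlen
    rw [hw] at hnd hmem hA
    rw [List.nodup_cons] at hnd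
    rw [av_cons_zero] at hA
    obtain ⟨t, ht⟩ := T_surj m w 1 hlen hnd.2 (by
      intro x
      have h1 := hmem x
      rw [List.mem_cons] at h1
      constructor
      · intro hx
        have := h1.1 (Or.inr hx)
        have : x ≠ 0 := fun h => hnd.1 (h ▸ hx)
        omega
      · intro hx
        rcases h1.2 (by omega) with h | h
        · omega
        · exact h) hA
    refine ⟨t, ?_, ?_⟩
    · simp only [Finset.mem_coe, BinaryTree.mem_treesOfNumNodesEq]
      rw [← hlen, ← ht, T_length]
    · simp only [ht, hw]
  · rintro ⟨t, ht, rfl⟩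
    simp only [Finset.mem_coe, BinaryTree.mem_treesOfNumNodesEq] at ht
    have hlen : (0 :: T t 1).length = m + 1 := by simp [T_length, ht]
    have hnd : (0 :: T t 1).Nodup := by
      rw [List.nodup_cons, T_mem]
      exact ⟨by omega, T_nodup _ _⟩
    have hmem : ∀ x ∈ 0 :: T t 1, x < m + 1 := by
      intro x hx
      rw [List.mem_cons, T_mem] at hx
      omega
    have hA : Av (0 :: T t 1) := (av_cons_zero _).2 (T_av _ _)
    have hl0 : ∀ h : 0 < (0 :: T t 1).length, (0 :: T t 1)[0] = 0 := fun _ => rfl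
    simp only
    clear ht
    revert hlen hnd hmem hA hl0
    generalize 0 :: T t 1 = l
    intro hlen hnd hmem hA hl0
    let f : Fin (m + 1) → Fin (m + 1) := fun i =>
      ⟨l[(i : ℕ)]'(by omega), hmem _ (List.getElem_mem _)⟩
    have hf : Function.Injective f := by
      intro a b h
      have := congrArg Fin.val h
      simp only [f] at this
      exact Fin.ext ((List.Nodup.getElem_inj_iff hnd).1 this)
    let σ : Equiv.Perm (Fin (m + 1)) := Equiv.ofBijective f (Finite.injective_iff_bijective.1 hf)
    have hσ : word σ = l := by
      apply List.ext_getElem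
      · simp [word, hlen]
      · intro i h1 h2
        simp only [word, List.getElem_ofFn]
        rfl
    refine ⟨σ, ⟨?_, ?_⟩, hσ⟩
    · apply Fin.ext
      simpa [σ, f] using hl0 (by omega)
    · rw [← word_av, hσ]
      exact hA

theorem S_ncard (m : ℕ) : (S m).ncard = catalan m := by
  rw [← Set.ncard_image_of_injective _ word_inj, image_word, Set.ncard_image_of_injective,
    Set.ncard_coe_finset, BinaryTree.treesOfNumNodesEq_card_eq_catalan]
  intro t t' h
  exact T_inj t t' 1 (List.cons.inj h).2

theorem rot_rot {m : ℕ} (σ : Fin (m + 1) → Fin (m + 1)) (r s : Fin (m + 1)) :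
    rotSeq (rotSeq σ s) r = rotSeq σ (r + s) := by
  funext i
  simp [rotSeq, add_assoc]

theorem contains_rot {m : ℕ} (σ : Fin (m + 1) → Fin (m + 1)) (s : Fin (m + 1))
    (h : CycContainsVinc1324bar (rotSeq σ s)) : CycContainsVinc1324bar σ := by
  obtain ⟨r, f, h1, h2, h3⟩ := h
  refine ⟨r + s, f, h1, h2, ?_⟩
  rw [← rot_rot]
  exact h3

theorem class_rot {m : ℕ} (σ : Fin (m + 1) → Fin (m + 1)) (s : Fin (m + 1)) :
    CycClass (rotSeq σ s) = CycClass σ := by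
  ext τ
  simp only [CycClass, Set.mem_range, rot_rot]
  constructor
  · rintro ⟨r, rfl⟩
    exact ⟨_, rfl⟩
  · rintro ⟨r, rfl⟩
    exact ⟨r - s, by simp⟩

theorem contains_iff {m : ℕ} (σ : Equiv.Perm (Fin (m + 1))) (h0 : σ 0 = 0) :
    CycContainsVinc1324bar σ ↔ ∃ i j k, i < j ∧ j < k ∧ σ j < σ i ∧ σ i < σ k := by
  constructor
  · rintro ⟨r, f, hf, hadj, hp⟩
    have f01 : f 0 < f 1 := hf (by decide)
    have f12 : f 1 < f 2 := hf (by decide)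
    have f23 : f 2 < f 3 := hf (by decide)
    have p1 := (hp 0 2).1 (by decide)
    have p2 := (hp 2 1).1 (by decide)
    have p3 := (hp 1 3).1 (by decide)
    simp only [rotSeq] at p1 p2 p3
    have val : ∀ x : Fin (m + 1), ((x + r : Fin (m+1)) : ℕ) =
        if (x : ℕ) + r < m + 1 then (x : ℕ) + r else (x : ℕ) + r - (m + 1) := by
      intro x
      rw [Fin.val_add]
      have := x.2
      have := r.2
      split_ifs with h
      · exact Nat.mod_eq_of_lt h
      · rw [Nat.mod_eq_sub_mod (by omega), Nat.mod_eq_of_lt (by omega)]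
    have v0 := val (f 0)
    have v1 := val (f 1)
    have v2 := val (f 2)
    have v3 := val (f 3)
    have hne : f 3 + r ≠ 0 := by
      intro h
      rw [h, h0] at p3
      exact absurd p3 (Fin.not_lt_zero _)
    have hne' : ((f 3 + r : Fin (m+1)) : ℕ) ≠ 0 := fun h => hne (Fin.ext h)
    by_cases hc : f 1 + r < f 2 + r ∧ f 2 + r < f 3 + r
    · exact ⟨_, _, _, hc.1, hc.2, p2, p3⟩
    · have hd : f 2 + r < f 0 + r ∧ f 0 + r < f 1 + r := by
        have := (f 3).2
        have := (f 2).2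
        have := (f 1).2
        have := (f 0).2
        have := r.2
        simp only [Fin.lt_def] at *
        split_ifs at v0 v1 v2 v3 <;> omega
      exact ⟨_, _, _, hd.1, hd.2, p1, p2⟩
  · rintro ⟨i, j, k, hij, hjk, h1, h2⟩
    have hp : ∃ p q : Fin (m + 1), i < p ∧ (q : ℕ) = p + 1 ∧ σ p < σ i ∧ σ i < σ q := by
      by_contra hcon
      push Not at hcon
      have key : ∀ d : ℕ, ∀ hd : (j : ℕ) + d < m + 1, σ ⟨j + d, hd⟩ < σ i := by
        intro d
        induction d with
        | zero => intro hd; exact h1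
        | succ d ih =>
          intro hd
          have a := ih (by omega)
          have b := hcon ⟨j + d, by omega⟩ ⟨j + (d + 1), hd⟩
            (by simp only [Fin.lt_def] at *; omega) (by simp; omega) a
          refine lt_of_le_of_ne b ?_
          intro he
          have := congrArg Fin.val (σ.injective he)
          simp only [Fin.lt_def] at *
          omega
      have hk := k.2
      simp only [Fin.lt_def] at hjk
      have := key (k - j) (by omega)
      have e : (⟨(j : ℕ) + (k - j), by omega⟩ : Fin (m + 1)) = k := Fin.ext (by simp; omega)
      rw [e] at this
      exact absurd this (not_lt.2 h2.le)
    obtain ⟨p, q, hip, hpq, q1, q2⟩ := hp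
    have hi0 : (0 : Fin (m + 1)) < i := by
      rw [Fin.pos_iff_ne_zero]
      rintro rfl
      rw [h0] at q1
      exact absurd q1 (Fin.not_lt_zero _)
    have hp0 : σ 0 < σ p := by
      rw [h0, Fin.pos_iff_ne_zero]
      intro h
      have : p = 0 := σ.injective (h.trans h0.symm)
      rw [this] at hip
      exact absurd hip (Fin.not_lt_zero _)
    have hpq' : p < q := by rw [Fin.lt_def]; omega
    refine ⟨0, ![0, i, p, q], ?_, hpq, ?_⟩
    · rw [Fin.strictMono_iff_lt_succ]
      intro a
      fin_cases a
      · exact hi0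
      · exact hip
      · exact hpq'
    · have r0 : rotSeq (⇑σ) 0 = σ := by funext x; simp [rotSeq]
      rw [r0]
      simp only [Fin.lt_def] at *
      intro a b
      fin_cases a <;> fin_cases b <;> simp <;> omega

theorem classes_eq (m : ℕ) :
    (AvClasses (m + 1) fun σ => ¬ CycContainsVinc1324bar σ) =
      (fun σ : Equiv.Perm (Fin (m + 1)) => CycClass ⇑σ) '' S m := by
  ext C
  constructor
  · rintro ⟨σ, rfl, h⟩
    let s := σ.symm 0
    let τ : Equiv.Perm (Fin (m + 1)) := (Equiv.addRight s).trans σ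
    have hτ : ⇑τ = rotSeq σ s := by
      funext i
      simp [τ, rotSeq]
    have hτ0 : τ 0 = 0 := by simp [τ, s]
    refine ⟨τ, ⟨hτ0, ?_⟩, ?_⟩
    · have : ¬ CycContainsVinc1324bar τ := by
        rw [hτ]
        exact fun h' => h (contains_rot _ _ h')
      rw [contains_iff τ hτ0] at this
      intro i j k hij hjk hh
      exact this ⟨i, j, k, hij, hjk, hh⟩
    · simp only [hτ, class_rot]
  · rintro ⟨σ, ⟨h0, hav⟩, rfl⟩
    refine ⟨σ, rfl, ?_⟩
    simp only
    rw [contains_iff σ h0]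
    rintro ⟨i, j, k, hij, hjk, hh⟩
    exact hav i j k hij hjk hh

theorem class_injOn (m : ℕ) :
    Set.InjOn (fun σ : Equiv.Perm (Fin (m + 1)) => CycClass ⇑σ) (S m) := by
  rintro σ ⟨hσ, -⟩ τ ⟨hτ, -⟩ h
  have h' : ⇑τ ∈ CycClass ⇑σ := by
    simp only at h
    rw [h]
    exact ⟨0, by funext x; simp [rotSeq]⟩
  obtain ⟨r, hr⟩ := h'
  have h1 := congrFun hr 0
  simp only [rotSeq, zero_add, hτ] at h1
  have h2 : r = 0 := σ.injective (h1.trans hσ.symm)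
  subst h2
  ext i
  have := congrFun hr i
  simp only [rotSeq, add_zero] at this
  rw [this]

end Vinc

/-- The number of cyclic permutations of length `n ≥ 1` avoiding the vincular
cyclic pattern `[13-24bar]` is the Catalan number `C_(n-1)`. -/
theorem card_av_vincular_1324bar (n : ℕ) (hn : 1 ≤ n) :
    (AvClasses n fun σ => ¬ CycContainsVinc1324bar σ).ncard = catalan (n - 1) := by
  obtain ⟨m, rfl⟩ : ∃ m, n = m + 1 := ⟨n - 1, by omega⟩
  rw [Vinc.classes_eq, (Vinc.class_injOn m).ncard_image, Vinc.S_ncard]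
  rfl
end
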